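/- (Lemma 1) Let λ_1 ≥ λ_2 ≥ … ≥ λ_{N_σ} ≥ 0, let σ² > 0, P > 0, and let N_q ≥ 1 be an integer. Consider feasible points of the quantizer/power allocation problem: nonnegative integers s_1,…,s_{N_σ} with Σ_{i=1}^{N_σ} s_i = N_q and reals ρ_1,…,ρ_{N_σ} ≥ 0 with Σ_{i=1}^{N_σ} ρ_i ≤ P, with objective Σ_{i=1}^{N_σ} C_φ(s_i, λ_i ρ_i/σ²). Call index i active if s_i ≥ 1 and ρ_i > 0. Then for any feasible point whose set of active indices has cardinality N_s, there exists a feasible point whose set of active indices is exactly {1,…,N_s} (the N_s strongest eigenchannels) and whose objective value is at least as large. -/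

import Mathlib

open Real MeasureTheory Filter

/-- The Gaussian Q-function `Q(x) = ∫_x^∞ (2π)^{-1/2} e^{-t²/2} dt`. -/
noncomputable def gaussQ (x : ℝ) : ℝ :=
  ∫ t in Set.Ioi x, (Real.sqrt (2 * Real.pi))⁻¹ * Real.exp (-t ^ 2 / 2)

/-- The conditional phase density `f(φ|ν)`. -/
noncomputable def phaseDensity (ν φ : ℝ) : ℝ :=
  Real.exp (-ν) / (2 * Real.pi) +
    Real.sqrt ν * Real.cos φ * Real.exp (-ν * Real.sin φ ^ 2) / Real.sqrt Real.pi *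
      (1 - gaussQ (Real.sqrt (2 * ν) * Real.cos φ))

/-- The phase quantization probability function `W_y^{(K)}(ν,θ)`. -/
noncomputable def Wq (K : ℕ) (ν θ : ℝ) (y : ℕ) : ℝ :=
  ∫ φ in (2 * Real.pi / K * y - Real.pi - θ)..(2 * Real.pi / K * (y + 1) - Real.pi - θ),
    phaseDensity ν φ

/-- The phase quantization entropy `w_K(ν,θ)` (base-2 logs; `0 · log₂ 0 = 0` since
`Real.logb 2 0 = 0`). -/
noncomputable def wEnt (K : ℕ) (ν θ : ℝ) : ℝ :=
  -∑ y ∈ Finset.range K, Wq K ν θ y * Real.logb 2 (Wq K ν θ y)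

/-- The capacity `C_φ(s,ν)` of a Gaussian channel with `2s`-sector phase quantization. -/
noncomputable def Cphi (s : ℕ) (ν : ℝ) : ℝ :=
  if 1 ≤ s then Real.logb 2 (2 * s) - wEnt (2 * s) ν (Real.pi / (2 * s)) else 0

/-- The lower Gaussian tail as a radial Gaussian integral. -/
theorem one_sub_gaussQ_sqrt_two_mul (b : ℝ) :
    1 - gaussQ (√2 * b) = (√π)⁻¹ * ∫ r in Set.Ioi (0 : ℝ), exp (-(r - b) ^ 2) := by
  set h : ℝ → ℝ := fun t => (√(2 * π))⁻¹ * exp (-t ^ 2 / 2) with hh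
  have h_eq : h = fun t => (√(2 * π))⁻¹ * exp (-(1 / 2) * t ^ 2) := by
    funext t; simp only [hh]; congr 2; ring
  have h_int : Integrable h := by
    rw [h_eq]; exact (integrable_exp_neg_mul_sq (by norm_num)).const_mul _
  have h_one : ∫ t, h t = 1 := by
    rw [h_eq, integral_const_mul, integral_gaussian]
    rw [show π / (1 / 2) = 2 * π by ring]
    exact inv_mul_cancel₀ (by positivity)
  have h_split := intervalIntegral.integral_Iic_add_Ioi (b := √2 * b) h_int.integrableOn
    h_int.integrableOn
  rw [h_one] at h_split
  have h_neg : ∫ t in Set.Iic (√2 * b), h t = ∫ t in Set.Ioi (-(√2 * b)), h t := by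
    rw [← integral_comp_neg_Iic]
    simp [hh]
  have h_shift : ∫ t in Set.Ioi (√2 * 0), h (t - √2 * b) = ∫ t in Set.Ioi (-(√2 * b)), h t := by
    have := (measurePreserving_sub_right volume (√2 * b)).setIntegral_preimage_emb
      (measurableEmbedding_subRight (√2 * b)) h (Set.Ioi (-(√2 * b)))
    rw [← this]
    simp
  have h_scale := integral_comp_mul_left_Ioi (fun t => h (t - √2 * b)) 0
    (show (0 : ℝ) < √2 by positivity)
  have h_fun : (fun r : ℝ => h (√2 * r - √2 * b)) =
      fun r => (√(2 * π))⁻¹ * exp (-(r - b) ^ 2) := by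
    funext r
    simp only [hh]
    rw [← mul_sub, mul_pow, sq_sqrt (by norm_num : (0 : ℝ) ≤ 2)]
    congr 2; ring
  simp only [h_fun] at h_scale
  rw [integral_const_mul, h_shift, ← h_neg, smul_eq_mul, sqrt_mul (by norm_num)] at h_scale
  have : gaussQ (√2 * b) = ∫ t in Set.Ioi (√2 * b), h t := rfl
  have h2 : (0 : ℝ) < √2 := by positivity
  have hpi : (0 : ℝ) < √π := by positivity
  rw [this, ← h_split, add_sub_cancel_right]
  field_simp at h_scale ⊢
  linarith

theorem integrable_exp_neg_sub_sq (b : ℝ) : Integrable fun r : ℝ => exp (-(r - b) ^ 2) := by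
  simpa using (integrable_exp_neg_mul_sq (b := 1) one_pos).comp_sub_right b

theorem integral_Ioi_mul_exp_neg_sub_sq (b : ℝ) :
    ∫ r in Set.Ioi (0 : ℝ), r * exp (-(r - b) ^ 2) =
      exp (-b ^ 2) / 2 + b * ∫ r in Set.Ioi (0 : ℝ), exp (-(r - b) ^ 2) := by
  have h_int : Integrable fun r : ℝ => (r - b) * exp (-(r - b) ^ 2) := by
    simpa using (integrable_mul_exp_neg_mul_sq (b := 1) one_pos).comp_sub_right b
  have h_tend : Tendsto (fun r : ℝ => -(exp (-(r - b) ^ 2) / 2)) atTop (nhds 0) := by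
    have : Tendsto (fun r : ℝ => (r - b) ^ 2) atTop atTop :=
      (tendsto_pow_atTop two_ne_zero).comp (tendsto_atTop_add_const_right _ (-b) tendsto_id)
    simpa using ((tendsto_exp_neg_atTop_nhds_zero.comp this).div_const 2).neg
  have h_ftc := integral_Ioi_of_hasDerivAt_of_tendsto' (a := 0)
    (f := fun r : ℝ => -(exp (-(r - b) ^ 2) / 2))
    (f' := fun r : ℝ => (r - b) * exp (-(r - b) ^ 2)) (m := 0)
    (fun r _ => by
      refine HasDerivAt.congr_deriv
        (((((hasDerivAt_id r).sub_const b).pow 2).neg.exp).div_const 2).neg ?_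
      simp only [Pi.neg_apply, Pi.pow_apply, id_eq, Nat.cast_ofNat]
      ring) h_int.integrableOn h_tend
  have h_split : (fun r : ℝ => r * exp (-(r - b) ^ 2)) =
      fun r => (r - b) * exp (-(r - b) ^ 2) + b * exp (-(r - b) ^ 2) := by
    funext r; ring
  rw [h_split, integral_add h_int.integrableOn
    ((integrable_exp_neg_sub_sq b).const_mul b).integrableOn, h_ftc, integral_const_mul]
  simp

/-- The phase density is the radial integral of the complex Gaussian density in polar
coordinates. -/
theorem phaseDensity_eq_integral {ν : ℝ} (hν : 0 ≤ ν) (φ : ℝ) :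
    phaseDensity ν φ = ∫ r in Set.Ioi (0 : ℝ),
      r * (π⁻¹ * (exp (-(r * cos φ - √ν) ^ 2) * exp (-(r * sin φ) ^ 2))) := by
  have h_fun : (fun r : ℝ =>
      r * (π⁻¹ * (exp (-(r * cos φ - √ν) ^ 2) * exp (-(r * sin φ) ^ 2)))) =
      fun r => (π⁻¹ * exp (-ν * sin φ ^ 2)) * (r * exp (-(r - √ν * cos φ) ^ 2)) := by
    funext r
    have : exp (-(r * cos φ - √ν) ^ 2) * exp (-(r * sin φ) ^ 2) =
        exp (-ν * sin φ ^ 2) * exp (-(r - √ν * cos φ) ^ 2) := by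
      rw [← exp_add, ← exp_add]
      congr 1
      have h1 := sq_sqrt hν
      have h2 := sin_sq_add_cos_sq φ
      linear_combination (-r ^ 2) * h2 + (cos φ ^ 2 - 1) * h1 + ν * h2
    rw [this]; ring
  have h_exp : exp (-ν) = exp (-ν * sin φ ^ 2) * exp (-(√ν * cos φ) ^ 2) := by
    rw [← exp_add, mul_pow, sq_sqrt hν]
    congr 1
    linear_combination ν * sin_sq_add_cos_sq φ
  have hpi : √π * √π = π := mul_self_sqrt pi_pos.le
  rw [h_fun, integral_const_mul, integral_Ioi_mul_exp_neg_sub_sq, phaseDensity,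
    sqrt_mul (by norm_num), mul_assoc √2, one_sub_gaussQ_sqrt_two_mul, h_exp, ← hpi]
  field_simp
  rw [sqrt_sq (sqrt_nonneg π)]
  ring

theorem phaseDensity_nonneg {ν : ℝ} (hν : 0 ≤ ν) (φ : ℝ) : 0 ≤ phaseDensity ν φ := by
  rw [phaseDensity_eq_integral hν]
  refine setIntegral_nonneg measurableSet_Ioi fun r hr => ?_
  have : (0 : ℝ) < r := hr
  positivity

theorem phaseDensity_periodic (ν : ℝ) : Function.Periodic (phaseDensity ν) (2 * π) := by
  intro φ
  simp [phaseDensity]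

/-- The polar-coordinate integrand is integrable, and its total mass is one. -/
theorem polar_gaussian (ν : ℝ) :
    IntegrableOn (fun p : ℝ × ℝ =>
        p.1 * (π⁻¹ * (exp (-(p.1 * cos p.2 - √ν) ^ 2) * exp (-(p.1 * sin p.2) ^ 2))))
        (Set.Ioi 0 ×ˢ Set.Ioo (-π) π) ∧
      ∫ p in (Set.Ioi (0 : ℝ) ×ˢ Set.Ioo (-π) π),
        p.1 * (π⁻¹ * (exp (-(p.1 * cos p.2 - √ν) ^ 2) * exp (-(p.1 * sin p.2) ^ 2))) = 1 := by
  have h_gauss (b : ℝ) : ∫ x : ℝ, exp (-(x - b) ^ 2) = √π := by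
    rw [integral_sub_right_eq_self (fun x : ℝ => exp (-x ^ 2)) b]
    simpa using integral_gaussian 1
  have h_cart : ∫ p : ℝ × ℝ, π⁻¹ * (exp (-(p.1 - √ν) ^ 2) * exp (-p.2 ^ 2)) = 1 := by
    rw [integral_const_mul, Measure.volume_eq_prod,
      integral_prod_mul (fun x : ℝ => exp (-(x - √ν) ^ 2)) (fun y : ℝ => exp (-y ^ 2)), h_gauss]
    have := h_gauss 0
    simp only [sub_zero] at this
    rw [this, mul_self_sqrt pi_pos.le]
    exact inv_mul_cancel₀ pi_ne_zero
  have h_polar := integral_comp_polarCoord_symm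
    (fun p : ℝ × ℝ => π⁻¹ * (exp (-(p.1 - √ν) ^ 2) * exp (-p.2 ^ 2)))
  rw [h_cart] at h_polar
  simp only [polarCoord_symm_apply, polarCoord_target, smul_eq_mul] at h_polar
  refine ⟨?_, h_polar⟩
  by_contra h_not
  rw [integral_undef h_not] at h_polar
  exact zero_ne_one h_polar

theorem phaseDensity_intervalIntegrable {ν : ℝ} (hν : 0 ≤ ν) (a b : ℝ) :
    IntervalIntegrable (phaseDensity ν) volume a b := by
  refine (phaseDensity_periodic ν).intervalIntegrable (t := -π) (by positivity) ?_ a b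
  rw [show -π + 2 * π = π by ring,
    intervalIntegrable_iff_integrableOn_Ioo_of_le (by linarith [pi_pos])]
  have h_int := (polar_gaussian ν).1
  rw [IntegrableOn, Measure.volume_eq_prod, ← Measure.prod_restrict] at h_int
  exact h_int.integral_prod_right.congr
    (Eventually.of_forall fun φ => (phaseDensity_eq_integral hν φ).symm)

theorem integral_phaseDensity {ν : ℝ} (hν : 0 ≤ ν) :
    ∫ φ in (-π)..π, phaseDensity ν φ = 1 := by
  obtain ⟨h_int, h_one⟩ := polar_gaussian ν
  rw [IntegrableOn, Measure.volume_eq_prod, ← Measure.prod_restrict] at h_int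
  rw [Measure.volume_eq_prod, ← Measure.prod_restrict, integral_prod_symm _ h_int] at h_one
  rw [intervalIntegral.integral_of_le (by linarith [pi_pos]), integral_Ioc_eq_integral_Ioo,
    ← h_one]
  simp only [phaseDensity_eq_integral hν]

theorem Wq_nonneg (K : ℕ) {ν : ℝ} (hν : 0 ≤ ν) (θ : ℝ) (y : ℕ) : 0 ≤ Wq K ν θ y := by
  refine intervalIntegral.integral_nonneg ?_ fun φ _ => phaseDensity_nonneg hν φ
  have : 0 ≤ 2 * π / K := by positivity
  linarith [mul_add (2 * π / K) (y : ℝ) 1]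

theorem sum_Wq {K : ℕ} (hK : K ≠ 0) {ν : ℝ} (hν : 0 ≤ ν) (θ : ℝ) :
    ∑ y ∈ Finset.range K, Wq K ν θ y = 1 := by
  have h_sum := intervalIntegral.sum_integral_adjacent_intervals (n := K)
    (a := fun k : ℕ => 2 * π / K * k - π - θ)
    (fun k _ => phaseDensity_intervalIntegrable hν _ _)
  have hK' : (K : ℝ) ≠ 0 := Nat.cast_ne_zero.2 hK
  have h_end : 2 * π / K * K - π - θ = (-π - θ) + 2 * π := by
    rw [div_mul_cancel₀ _ hK']; ring
  simp only [Nat.cast_zero, mul_zero, zero_sub, Nat.cast_add, Nat.cast_one, h_end] at h_sum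
  have h_per := (phaseDensity_periodic ν).intervalIntegral_add_eq (-π - θ) (-π)
  rw [show -π + 2 * π = π by ring, integral_phaseDensity hν] at h_per
  rw [h_per] at h_sum
  exact h_sum

/-- The entropy of a distribution on `K` points is at most `log₂ K`. -/
theorem wEnt_le {K : ℕ} (hK : K ≠ 0) {ν : ℝ} (hν : 0 ≤ ν) (θ : ℝ) :
    wEnt K ν θ ≤ logb 2 K := by
  have hK' : (0 : ℝ) < K := Nat.cast_pos.2 (Nat.pos_of_ne_zero hK)
  have h_jensen := concaveOn_negMulLog.le_map_sum (t := Finset.range K)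
    (w := fun _ => (K : ℝ)⁻¹) (p := Wq K ν θ) (fun _ _ => by positivity)
    (by simp [hK'.ne']) (fun y _ => Wq_nonneg K hν θ y)
  simp only [smul_eq_mul, ← Finset.mul_sum, sum_Wq hK hν, mul_one, negMulLog, log_inv] at h_jensen
  have h_nat : ∑ y ∈ Finset.range K, -Wq K ν θ y * log (Wq K ν θ y) ≤ log K := by
    exact le_of_mul_le_mul_left (h_jensen.trans_eq (by ring : _ = (K : ℝ)⁻¹ * log K))
      (inv_pos.2 hK')
  have h_ent : wEnt K ν θ =
      (∑ y ∈ Finset.range K, -Wq K ν θ y * log (Wq K ν θ y)) / log 2 := by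
    simp only [wEnt, logb, neg_mul, Finset.sum_neg_distrib, neg_div, Finset.sum_div, mul_div_assoc]
  rw [h_ent, logb]
  exact div_le_div_of_nonneg_right h_nat (log_pos one_lt_two).le

theorem wEnt_zero {K : ℕ} (hK : K ≠ 0) (θ : ℝ) : wEnt K 0 θ = logb 2 K := by
  have hK' : (K : ℝ) ≠ 0 := Nat.cast_ne_zero.2 hK
  have h_unif (y : ℕ) : Wq K 0 θ y = (K : ℝ)⁻¹ := by
    simp only [Wq, phaseDensity, neg_zero, exp_zero, sqrt_zero, zero_mul, zero_div, add_zero,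
      intervalIntegral.integral_const, smul_eq_mul]
    field_simp
    ring
  simp [wEnt, h_unif, logb_inv, hK']

theorem Cphi_nonneg (s : ℕ) {ν : ℝ} (hν : 0 ≤ ν) : 0 ≤ Cphi s ν := by
  unfold Cphi
  split_ifs with hs
  · have := wEnt_le (K := 2 * s) (by omega) hν (π / (2 * s))
    push_cast at this
    linarith
  · exact le_rfl

theorem Cphi_zero_right (s : ℕ) : Cphi s 0 = 0 := by
  unfold Cphi
  split_ifs with hs
  · have := wEnt_zero (K := 2 * s) (by omega) (π / (2 * s))
    push_cast at this
    linarith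
  · rfl

/-- An order-preserving relabelling: some permutation carries the first `#A` indices onto `A`,
moving none of them down. -/
theorem exists_perm_initial_segment {n : ℕ} (A : Finset (Fin n)) :
    ∃ e : Equiv.Perm (Fin n),
      (∀ i, e i ∈ A ↔ (i : ℕ) < A.card) ∧ ∀ i : Fin n, (i : ℕ) < A.card → i ≤ e i := by
  have hA : A.card ≤ n := by simpa using A.card_le_univ
  let f : {i : Fin n // (i : ℕ) < A.card} ≃ {i : Fin n // i ∈ A} :=
    { toFun := fun i => ⟨i.1, i.2⟩
      invFun := fun k => ⟨⟨k, k.2.trans_le hA⟩, k.2⟩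
      left_inv := fun _ => rfl
      right_inv := fun _ => rfl : {i : Fin n // (i : ℕ) < A.card} ≃ Fin A.card }.trans
    (A.orderIsoOfFin rfl).toEquiv
  have h_le : ∀ (k : ℕ) (hk : k < A.card), k ≤ (A.orderIsoOfFin rfl ⟨k, hk⟩ : Fin n) := by
    intro k
    induction k with
    | zero => intro _; exact Nat.zero_le _
    | succ k ih =>
      intro hk
      have h_lt : A.orderIsoOfFin rfl ⟨k, by omega⟩ < A.orderIsoOfFin rfl ⟨k + 1, hk⟩ :=
        (A.orderIsoOfFin rfl).strictMono (Fin.mk_lt_mk.2 k.lt_succ_self)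
      exact (ih (by omega)).trans_lt h_lt
  refine ⟨f.extendSubtype, fun i => ⟨fun hi => ?_, fun hi => f.extendSubtype_mem i hi⟩,
    fun i hi => ?_⟩
  · by_contra h
    exact f.extendSubtype_not_mem i h hi
  · rw [f.extendSubtype_apply_of_mem i hi]
    exact h_le i hi

/-- Power on a weaker channel can be replaced by no more power on a stronger one, without
changing whether it is positive and without decreasing the capacity. -/
theorem exists_power_of_gain_le (s : ℕ) {a b ρ σ2 : ℝ} (ha : 0 ≤ a) (hab : a ≤ b) (hρ : 0 ≤ ρ)
    (hσ2 : 0 < σ2) :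
    ∃ ρ', 0 ≤ ρ' ∧ ρ' ≤ ρ ∧ (0 < ρ' ↔ 0 < ρ) ∧ Cphi s (a * ρ / σ2) ≤ Cphi s (b * ρ' / σ2) := by
  have hb : 0 ≤ b := ha.trans hab
  rcases ha.eq_or_lt with rfl | ha'
  · refine ⟨ρ, hρ, le_rfl, Iff.rfl, ?_⟩
    rw [zero_mul, zero_div, Cphi_zero_right]
    exact Cphi_nonneg s (by positivity)
  · have hb' : 0 < b := ha'.trans_le hab
    refine ⟨a / b * ρ, by positivity, mul_le_of_le_one_left hρ ((div_le_one hb').2 hab),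
      mul_pos_iff_of_pos_left (by positivity), le_of_eq ?_⟩
    congr 2
    field_simp

/-- Lemma 1: if a feasible quantizer/power allocation has `N_s` active
eigenchannels, then there is a feasible allocation whose active channels are exactly the
`N_s` strongest eigenchannels and whose objective is at least as large. -/
theorem active_channels_strongest (Nσ Nq : ℕ) (hNq : 1 ≤ Nq)
    (lam : Fin Nσ → ℝ) (hlam_mono : Antitone lam) (hlam_nonneg : ∀ i, 0 ≤ lam i)
    (σ2 P : ℝ) (hσ2 : 0 < σ2) (hP : 0 < P)
    (s : Fin Nσ → ℕ) (hs_sum : ∑ i, s i = Nq)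
    (ρ : Fin Nσ → ℝ) (hρ_nonneg : ∀ i, 0 ≤ ρ i) (hρ_sum : ∑ i, ρ i ≤ P)
    (Ns : ℕ)
    (hNs : (Finset.univ.filter fun i : Fin Nσ => 1 ≤ s i ∧ 0 < ρ i).card = Ns) :
    ∃ (s' : Fin Nσ → ℕ) (ρ' : Fin Nσ → ℝ),
      (∑ i, s' i = Nq) ∧ (∀ i, 0 ≤ ρ' i) ∧ (∑ i, ρ' i ≤ P) ∧
      (∀ i : Fin Nσ, (1 ≤ s' i ∧ 0 < ρ' i) ↔ (i : ℕ) < Ns) ∧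
      ∑ i, Cphi (s i) (lam i * ρ i / σ2) ≤ ∑ i, Cphi (s' i) (lam i * ρ' i / σ2) := by
  subst hNs
  obtain ⟨e, he_mem, he_le⟩ :=
    exists_perm_initial_segment (Finset.univ.filter fun i : Fin Nσ => 1 ≤ s i ∧ 0 < ρ i)
  simp only [Finset.mem_filter, Finset.mem_univ, true_and] at he_mem
  have h_power (i : Fin Nσ) : ∃ ρ', 0 ≤ ρ' ∧ ρ' ≤ ρ (e i) ∧ (0 < ρ' ↔ 0 < ρ (e i)) ∧
      Cphi (s (e i)) (lam (e i) * ρ (e i) / σ2) ≤ Cphi (s (e i)) (lam i * ρ' / σ2) := by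
    by_cases hi : 1 ≤ s (e i) ∧ 0 < ρ (e i)
    · exact exists_power_of_gain_le _ (hlam_nonneg _) (hlam_mono (he_le i ((he_mem i).1 hi)))
        (hρ_nonneg _) hσ2
    · refine ⟨ρ (e i), hρ_nonneg _, le_rfl, Iff.rfl, ?_⟩
      rcases not_and_or.1 hi with hs | hr
      · simp [Cphi, hs]
      · simp [le_antisymm (not_lt.1 hr) (hρ_nonneg _)]
  choose ρ' h_nonneg h_le h_pos h_cap using h_power
  refine ⟨s ∘ e, ρ', ?_, h_nonneg, ?_, fun i => ?_, ?_⟩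
  · rw [← hs_sum]
    exact Equiv.sum_comp e s
  · exact (Finset.sum_le_sum fun i _ => h_le i).trans ((Equiv.sum_comp e ρ).trans_le hρ_sum)
  · rw [h_pos i]
    exact he_mem i
  · rw [← Equiv.sum_comp e]
    exact Finset.sum_le_sum fun i _ => h_cap i
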